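/- Let T be an abelian group (written multiplicatively), I an index type with at least two elements, and (T_i)_{i ∈ I} a family of nontrivial subgroups of T satisfying: (a) for pairwise distinct i, j, k ∈ I one has (T_i * T_j) ∩ T_k = {1}; (b) T is generated by the union of the T_i; (c) for all distinct i, j ∈ I and all a ∈ T_i \ {1}, b ∈ T_j \ {1}, there exist distinct k, l ∈ I with {k, l} ∩ {i, j} = ∅ and elements c ∈ T_k \ {1}, d ∈ T_l \ {1} such that a * b = c * d. If β and γ are group endomorphisms of T with β(T_i) ⊆ T_i and γ(T_i) ⊆ T_i for all i ∈ I, and the composite β ∘ γ is the trivial endomorphism (sending every element to 1), then β is trivial or γ is trivial. -/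

import Mathlib

open scoped Pointwise

/-- An endomorphism trivial on every member of a generating family of subgroups is trivial. -/
theorem MonoidHom.eq_one_of_closure_iUnion_eq_top {T : Type*} [Group T] {I : Type*}
    {Ts : I → Subgroup T} (hb : Subgroup.closure (⋃ i, (Ts i : Set T)) = ⊤)
    (φ : T →* T) (h : ∀ i, ∀ x ∈ Ts i, φ x = 1) (t : T) : φ t = 1 := by
  have hle : Subgroup.closure (⋃ i, (Ts i : Set T)) ≤ φ.ker := by
    rw [Subgroup.closure_le]
    exact Set.iUnion_subset fun i x hx => h i x hx
  exact hle (hb ▸ Subgroup.mem_top t)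

/-- If an endomorphism preserving the members of a Kantor family kills a nontrivial element of
`Ts i`, then it kills every other member `Ts j`. -/
theorem kantor_kernel_trivial_on_of_ne {T : Type*} [CommGroup T] {I : Type*}
    {Ts : I → Subgroup T}
    (ha : ∀ i j k : I, i ≠ j → j ≠ k → i ≠ k →
      ((Ts i : Set T) * (Ts j : Set T)) ∩ (Ts k : Set T) = {1})
    (hc : ∀ i j : I, i ≠ j → ∀ a ∈ Ts i, a ≠ 1 → ∀ b ∈ Ts j, b ≠ 1 →
      ∃ k l : I, k ≠ l ∧ k ≠ i ∧ k ≠ j ∧ l ≠ i ∧ l ≠ j ∧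
        ∃ c ∈ Ts k, c ≠ 1 ∧ ∃ d ∈ Ts l, d ≠ 1 ∧ a * b = c * d)
    {β : T →* T} (hβ : ∀ i : I, ∀ x ∈ Ts i, β x ∈ Ts i)
    {i j : I} (hij : i ≠ j) {a : T} (hai : a ∈ Ts i) (ha1 : a ≠ 1) (hβa : β a = 1)
    {b : T} (hbj : b ∈ Ts j) : β b = 1 := by
  by_cases hb1 : b = 1
  · rw [hb1, map_one]
  obtain ⟨k, l, hkl, -, hkj, -, hlj, c, hck, -, d, hdl, -, habcd⟩ :=
    hc i j hij a hai ha1 b hbj hb1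
  have hprod : β c * β d = β b := by
    rw [← map_mul, ← habcd, map_mul, hβa, one_mul]
  have hmem : β b ∈ ((Ts k : Set T) * (Ts l : Set T)) ∩ (Ts j : Set T) :=
    ⟨⟨β c, hβ k c hck, β d, hβ l d hdl, hprod⟩, hβ j b hbj⟩
  rwa [ha k l j hkl hlj hkj] at hmem

/-- Under the same Kantor-family style hypotheses as in Statement 0,
the ring of endomorphisms of `T` mapping every `Ts i` into itself has no zero divisors:
if the composite `β ∘ γ` of two such endomorphisms is trivial, then `β` or `γ` is trivial. -/
theorem kantor_kernel_no_zero_divisors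
    {T : Type*} [CommGroup T] {I : Type*}
    (Ts : I → Subgroup T)
    (hI : ∃ i j : I, i ≠ j)
    (hnontriv : ∀ i, Ts i ≠ ⊥)
    -- (a) for pairwise distinct i, j, k : (T_i * T_j) ∩ T_k = {1}
    (ha : ∀ i j k : I, i ≠ j → j ≠ k → i ≠ k →
      ((Ts i : Set T) * (Ts j : Set T)) ∩ (Ts k : Set T) = {1})
    -- (b) T is generated by the union of the T_i
    (hb : Subgroup.closure (⋃ i, (Ts i : Set T)) = ⊤)
    -- (c) thickness condition
    (hc : ∀ i j : I, i ≠ j → ∀ a ∈ Ts i, a ≠ 1 → ∀ b ∈ Ts j, b ≠ 1 →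
      ∃ k l : I, k ≠ l ∧ k ≠ i ∧ k ≠ j ∧ l ≠ i ∧ l ≠ j ∧
        ∃ c ∈ Ts k, c ≠ 1 ∧ ∃ d ∈ Ts l, d ≠ 1 ∧ a * b = c * d)
    (β γ : T →* T)
    (hβ : ∀ i : I, ∀ x ∈ Ts i, β x ∈ Ts i)
    (hγ : ∀ i : I, ∀ x ∈ Ts i, γ x ∈ Ts i)
    (hcomp : ∀ t : T, β (γ t) = 1) :
    (∀ t : T, β t = 1) ∨ (∀ t : T, γ t = 1) := by
  by_cases hγ1 : ∀ i, ∀ x ∈ Ts i, γ x = 1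
  · exact Or.inr (γ.eq_one_of_closure_iUnion_eq_top hb hγ1)
  push Not at hγ1
  obtain ⟨i, x, hx, hγx⟩ := hγ1
  have hother : ∀ j, i ≠ j → ∀ b ∈ Ts j, β b = 1 := fun j hij b hbj =>
    kantor_kernel_trivial_on_of_ne ha hc hβ hij (hγ i x hx) hγx (hcomp x) hbj
  refine Or.inl (β.eq_one_of_closure_iUnion_eq_top hb fun j b hbj => ?_)
  by_cases hij : i = j
  · subst hij
    have : Nontrivial I := ⟨hI⟩
    obtain ⟨m, hm⟩ := exists_ne i
    obtain ⟨y, hym, hy1⟩ := (Ts m).bot_or_exists_ne_one.resolve_left (hnontriv m)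
    exact kantor_kernel_trivial_on_of_ne ha hc hβ hm hym hy1 (hother m hm.symm y hym) hbj
  · exact hother j hij b hbj
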